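/- arXiv:cs/0206023 — 2 statements merged into one kernel-verified Lean document; each statement's English description precedes it below -/
import Mathlib

section
/- Let Q1 and Q2 be conjunctive queries with the same head, such that no non-head variable of Q1 occurs in Q2 and no non-head variable of Q2 occurs in Q1, and let Q2' be the conjunctive query whose head is the common head and whose body is the union of the bodies of Q1 and Q2. Then (i) Q2' is contained in Q1, i.e., Q2'(J) ⊆ Q1(J) for every instance J; and (ii) for any instance I with Q2(I) ⊆ Q1(I), we have Q2'(I) = Q2(I). (Thus every rule Q1 ⇒ Q2 holding on I in the sense Q2(I) ⊆ Q1(I) can be expressed by the rule Q1 ⇒ Q2' whose right-hand side is contained in Q1 on all instances.) -/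
/-- A relational schema: a type of relation names with an arity function. -/
structure Schema where
  RelName : Type
  arity : RelName → ℕ

/-- An atom `R(x̄)` over schema `S`, with variables from `V` and constants from `D`:
a relation name together with an `arity R`-tuple of terms (variables or constants). -/
structure Atom (S : Schema) (V D : Type) where
  rel : S.RelName
  args : Fin (S.arity rel) → V ⊕ D

/-- A conjunctive query: a finite body (a list of atoms) and a head (a tuple of variables). -/
structure CQ (S : Schema) (V D : Type) where
  body : List (Atom S V D)
  head : List V

/-- An instance assigns to each relation name a set of tuples over the domain `D`. -/
def Instance (S : Schema) (D : Type) := ∀ R : S.RelName, Set (Fin (S.arity R) → D)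

/-- Apply a valuation to a term, leaving constants fixed. -/
def applyVal {V D : Type} (f : V → D) : V ⊕ D → D
  | Sum.inl v => f v
  | Sum.inr c => c

/-- A valuation `f` is a matching of `Q` in `I` if it sends every atom of the body
into the corresponding relation of the instance. -/
def IsMatching {S : Schema} {V D : Type} (Q : CQ S V D) (I : Instance S D) (f : V → D) : Prop :=
  ∀ a ∈ Q.body, (fun i => applyVal f (a.args i)) ∈ I a.rel

/-- The answer `Q(I)`: the set of tuples `f(head)` over all matchings `f` of `Q` in `I`. -/
def answer {S : Schema} {V D : Type} (Q : CQ S V D) (I : Instance S D) : Set (List D) :=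
  {t | ∃ f : V → D, IsMatching Q I f ∧ t = Q.head.map f}

/-- The support of `Q` in `I` is the number of distinct tuples in the answer of `Q` on `I`. -/
noncomputable def support {S : Schema} {V D : Type} (Q : CQ S V D) (I : Instance S D) : ℕ :=
  (answer Q I).ncard

/-- `Q1` is contained in `Q2`: heads of the same length and `Q1(I) ⊆ Q2(I)` for every instance. -/
def Contained {S : Schema} {V D : Type} (Q1 Q2 : CQ S V D) : Prop :=
  Q1.head.length = Q2.head.length ∧ ∀ I : Instance S D, answer Q1 I ⊆ answer Q2 I

/-- Variable `v` occurs in atom `a`. -/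
def VarInAtom {S : Schema} {V D : Type} (v : V) (a : Atom S V D) : Prop :=
  ∃ i, a.args i = Sum.inl v

/-- Variable `v` occurs in a body (a list of atoms). -/
def VarInBody {S : Schema} {V D : Type} (v : V) (b : List (Atom S V D)) : Prop :=
  ∃ a ∈ b, VarInAtom v a

/-- Variable `v` occurs in the query `Q` (in its body or in its head). -/
def VarInQuery {S : Schema} {V D : Type} (v : V) (Q : CQ S V D) : Prop :=
  VarInBody v Q.body ∨ v ∈ Q.head

theorem applyVal_congr_of_varInAtom {S : Schema} {V D : Type} {a : Atom S V D} {f g : V → D}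
    (h : ∀ v, VarInAtom v a → f v = g v) :
    (fun i => applyVal f (a.args i)) = fun i => applyVal g (a.args i) := by
  funext i
  cases hi : a.args i with
  | inl v => exact h v ⟨i, hi⟩
  | inr c => rfl

/-- Whether a valuation is a matching depends only on its values on the variables of the body. -/
theorem IsMatching.congr {S : Schema} {V D : Type} {Q : CQ S V D} {I : Instance S D}
    {f g : V → D} (hf : IsMatching Q I f) (h : ∀ v, VarInBody v Q.body → f v = g v) :
    IsMatching Q I g := by
  intro a ha
  rw [← applyVal_congr_of_varInAtom fun v hv => h v ⟨a, ha, hv⟩]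
  exact hf a ha

/-- Let `Q1`, `Q2` have the same head, with no non-head variable of `Q1` occurring in `Q2` and
vice versa, and let `Q2'` have the common head and the union of the two bodies as body. Then
(i) `Q2'` is contained in `Q1` (on all instances), and (ii) on any instance `I` with
`Q2(I) ⊆ Q1(I)` we have `Q2'(I) = Q2(I)`. -/
theorem rule_intersection_rewrite {S : Schema} {V D : Type} (Q1 Q2 Q2' : CQ S V D)
    (hhead : Q1.head = Q2.head)
    (hdisj1 : ∀ v : V, VarInQuery v Q1 → v ∉ Q1.head → ¬ VarInQuery v Q2)
    (hdisj2 : ∀ v : V, VarInQuery v Q2 → v ∉ Q2.head → ¬ VarInQuery v Q1)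
    (hbody : ∀ a : Atom S V D, a ∈ Q2'.body ↔ a ∈ Q1.body ∨ a ∈ Q2.body)
    (hhead' : Q2'.head = Q1.head) :
    Contained Q2' Q1 ∧
    ∀ I : Instance S D, answer Q2 I ⊆ answer Q1 I → answer Q2' I = answer Q2 I := by
  refine ⟨⟨by rw [hhead'], ?_⟩, fun I hI => Set.Subset.antisymm ?_ ?_⟩
  · rintro J t ⟨f, hf, rfl⟩
    exact ⟨f, fun a ha => hf a ((hbody a).2 (Or.inl ha)), by rw [hhead']⟩
  · rintro t ⟨f, hf, rfl⟩
    exact ⟨f, fun a ha => hf a ((hbody a).2 (Or.inr ha)), by rw [hhead', hhead]⟩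
  · rintro t ⟨f, hf, rfl⟩
    obtain ⟨g, hg, hfg⟩ := hI ⟨f, hf, rfl⟩
    rw [← hhead, List.map_inj_left] at hfg
    classical
    let h : V → D := fun v => if VarInQuery v Q2 then f v else g v
    have h_eq_f : ∀ v, VarInQuery v Q2 → f v = h v := fun v hv => (if_pos hv).symm
    have h_eq_g : ∀ v, VarInBody v Q1.body → g v = h v := by
      intro v hv
      by_cases hv2 : VarInQuery v Q2
      · have hv1 : v ∈ Q1.head := by
          by_contra hn
          exact hdisj1 v (Or.inl hv) hn hv2
        rw [← h_eq_f v hv2, hfg v hv1]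
      · exact (if_neg hv2).symm
    refine ⟨h, fun a ha => ?_, ?_⟩
    · rcases (hbody a).1 ha with ha | ha
      · exact hg.congr h_eq_g a ha
      · exact hf.congr (fun v hv => h_eq_f v (Or.inl hv)) a ha
    · rw [hhead', hhead]
      exact List.map_congr_left fun v hv => h_eq_f v (Or.inr hv)
end

section
/- (Levelwise algorithm: soundness and completeness.) Let L be a finite set of patterns with a partial order ⪯, and let q : L → Prop be monotone with respect to ⪯ (if q(φ) and φ ⪯ γ then q(γ)). Define C₁ to be the set of maximal elements of L, and recursively Fᵢ = {φ ∈ Cᵢ | q(φ)} and C_{i+1} = {φ ∈ L | every γ with φ ≺ γ lies in ⋃_{j ≤ i} Fⱼ} \ ⋃_{j ≤ i} Cⱼ, where φ ≺ γ means φ ⪯ γ and not γ ⪯ φ. Then ⋃_{i ≥ 1} Fᵢ = {φ ∈ L | q(φ)}. -/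
/-- Levelwise algorithm, soundness and completeness: let `L` be a finite set of patterns with
a partial order, and `q` a predicate monotone with respect to it. If `C 1` is the set of
maximal elements, `F i = {φ ∈ C i | q φ}` for `i ≥ 1`, and
`C (i+1) = {φ | every γ with φ < γ lies in ⋃_{1 ≤ j ≤ i} F j} \ ⋃_{1 ≤ j ≤ i} C j`,
then `⋃_{i ≥ 1} F i = {φ | q φ}`. -/
theorem levelwise_sound_complete {L : Type} [Fintype L] [PartialOrder L]
    (q : L → Prop) (hmono : ∀ φ γ : L, q φ → φ ≤ γ → q γ)
    (C F : ℕ → Set L)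
    (hC1 : C 1 = {φ : L | ∀ γ : L, ¬ φ < γ})
    (hF : ∀ i, 1 ≤ i → F i = {φ ∈ C i | q φ})
    (hCsucc : ∀ i, 1 ≤ i →
      C (i + 1) =
        {φ : L | ∀ γ : L, φ < γ → ∃ j, 1 ≤ j ∧ j ≤ i ∧ γ ∈ F j} \
        {φ : L | ∃ j, 1 ≤ j ∧ j ≤ i ∧ φ ∈ C j}) :
    (⋃ i ∈ {i : ℕ | 1 ≤ i}, F i) = {φ : L | q φ} := by
  have finite_level : ∀ φ : L, q φ → ∃ i, 1 ≤ i ∧ φ ∈ F i := by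
    intro φ
    induction φ using (wellFounded_gt (α := L)).induction with
    | _ φ ih =>
      intro hφ
      have above : ∀ γ : L, ∃ j, φ < γ → 1 ≤ j ∧ γ ∈ F j := by
        intro γ
        by_cases h : φ < γ
        · obtain ⟨j, hj⟩ := ih γ h (hmono φ γ hφ h.le)
          exact ⟨j, fun _ => hj⟩
        · exact ⟨0, fun h' => absurd h' h⟩
      choose level hlevel using above
      have mem_F : ∀ i, 1 ≤ i → φ ∈ C i → ∃ i, 1 ≤ i ∧ φ ∈ F i := by
        intro i hi hC
        exact ⟨i, hi, by rw [hF i hi]; exact ⟨hC, hφ⟩⟩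
      let N := Finset.univ.sup level + 1
      by_cases hC : ∃ j, 1 ≤ j ∧ j ≤ N ∧ φ ∈ C j
      · obtain ⟨j, hj, -, hφj⟩ := hC
        exact mem_F j hj hφj
      · refine mem_F (N + 1) (Nat.le_add_left 1 N) ?_
        rw [hCsucc N (Nat.le_add_left 1 _)]
        refine ⟨fun γ hγ => ⟨level γ, (hlevel γ hγ).1, ?_, (hlevel γ hγ).2⟩, hC⟩
        exact (Finset.le_sup (Finset.mem_univ γ)).trans (Nat.le_succ _)
  ext φ
  simp only [Set.mem_iUnion, Set.mem_ofPred_eq, exists_prop]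
  refine ⟨?_, finite_level φ⟩
  rintro ⟨i, hi, hφ⟩
  rw [hF i hi] at hφ
  exact hφ.2
end
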